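/- arXiv:1004.4828 — 2 statements merged into one kernel-verified Lean document; each statement's English description precedes it below -/
import Mathlib

section
/- Suppose that for all f ∈ C_c^∞(Ω), the fractional Hardy inequality I_α^Ω(f) ≥ D ∫_Ω |f(x)|^p d_Ω(x)^{−α} dx holds with D > 0, and for all f ∈ C_c^∞(ℝⁿ) the fractional Sobolev inequality I_α^{ℝⁿ}(f) ≥ S ‖f‖_{p*}^p holds with S > 0, where p* = np/(n−α). Then for all f ∈ C_c^∞(Ω), I_α^Ω(f) ≥ S·(1 + 2|𝕊^{n−1}|/(α D))^{−1} ‖f‖_{p*}^p. -/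
open MeasureTheory Real

/-- Integral of `|y|^{-n-α}` over the complement of a ball of radius `d`. -/
lemma tail_lintegral (n : ℕ) (hn : 1 ≤ n) (α d : ℝ) (hα : 0 < α) (hd : 0 < d) :
    ∫⁻ y : EuclideanSpace ℝ (Fin n),
      ENNReal.ofReal ((Set.Ici d).indicator (fun r : ℝ => r ^ (-(n : ℝ) - α)) ‖y‖) =
    ENNReal.ofReal ((2 * π ^ ((n : ℝ) / 2) / Real.Gamma ((n : ℝ) / 2)) / α * d ^ (-α)) := by
  have : NeZero n := ⟨by omega⟩
  have : Nonempty (Fin n) := ⟨0⟩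
  set g : ℝ → ℝ := (Set.Ici d).indicator (fun r : ℝ => r ^ (-(n : ℝ) - α)) with hg
  have hn0 : (0 : ℝ) < n := by exact_mod_cast hn
  have key : ∀ y : ℝ, y ^ (n - 1) • g y =
      (Set.Ici d).indicator (fun r : ℝ => r ^ (-1 - α)) y := by
    intro y
    by_cases hy : y ∈ Set.Ici d
    · have hy0 : 0 < y := lt_of_lt_of_le hd hy
      simp only [hg, Set.indicator_of_mem hy, smul_eq_mul]
      rw [← Real.rpow_natCast, ← Real.rpow_add hy0]
      congr 1
      push_cast [Nat.cast_sub hn]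
      ring
    · simp [hg, Set.indicator_of_notMem hy]
  have hsub : Set.Ici d ⊆ Set.Ioi (0 : ℝ) := fun y hy => lt_of_lt_of_le hd hy
  have hint1 : IntegrableOn (fun r : ℝ => r ^ (-1 - α)) (Set.Ici d) := by
    rw [integrableOn_Ici_iff_integrableOn_Ioi]
    exact integrableOn_Ioi_rpow_of_lt (by linarith) hd
  have hint : Integrable (fun y : EuclideanSpace ℝ (Fin n) => g ‖y‖) := by
    rw [integrable_fun_norm_addHaar]
    simp only [finrank_euclideanSpace, Fintype.card_fin]
    simp_rw [key]
    exact (hint1.integrable_indicator measurableSet_Ici).integrableOn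
  have hnn : ∀ r, 0 ≤ g r := by
    intro r
    apply Set.indicator_nonneg
    intro y hy
    exact Real.rpow_nonneg (lt_of_lt_of_le hd hy).le _
  rw [← ofReal_integral_eq_lintegral_ofReal hint (Filter.Eventually.of_forall fun y => hnn _)]
  congr 1
  rw [integral_fun_norm_addHaar]
  simp only [finrank_euclideanSpace, Fintype.card_fin]
  simp_rw [key]
  rw [setIntegral_indicator measurableSet_Ici, Set.inter_eq_right.mpr hsub,
    integral_Ici_eq_integral_Ioi, integral_Ioi_rpow_of_lt (by linarith) hd]
  have hvol : volume.real (Metric.ball (0 : EuclideanSpace ℝ (Fin n)) 1) =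
      π ^ ((n : ℝ) / 2) / ((n : ℝ) / 2 * Real.Gamma ((n : ℝ) / 2)) := by
    have hG : 0 < Real.Gamma ((n : ℝ) / 2) := Real.Gamma_pos_of_pos (by positivity)
    rw [Measure.real, EuclideanSpace.volume_ball, Fintype.card_fin,
      Real.Gamma_add_one (by positivity), ENNReal.ofReal_one, one_pow, one_mul,
      ENNReal.toReal_ofReal (by positivity)]
    congr 1
    rw [Real.sqrt_eq_rpow, ← Real.rpow_natCast, ← Real.rpow_mul Real.pi_pos.le]
    congr 1
    ring
  have hG : 0 < Real.Gamma ((n : ℝ) / 2) := Real.Gamma_pos_of_pos (by positivity)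
  rw [hvol, show (-1 - α + 1) = -α by ring]
  simp only [nsmul_eq_mul, smul_eq_mul]
  field_simp

/-- The potential of the complement is controlled by the distance to the boundary. -/
lemma compl_potential (n : ℕ) (hn : 1 ≤ n) (α : ℝ) (hα : 0 < α)
    (Ω : Set (EuclideanSpace ℝ (Fin n))) (hΩ : IsOpen Ω) (hΩc : Ωᶜ.Nonempty)
    (x : EuclideanSpace ℝ (Fin n)) (hx : x ∈ Ω) :
    ∫⁻ y in Ωᶜ, ENNReal.ofReal (dist x y ^ (-(n : ℝ) - α)) ≤
    ENNReal.ofReal ((2 * π ^ ((n : ℝ) / 2) / Real.Gamma ((n : ℝ) / 2)) / α *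
      Metric.infDist x Ωᶜ ^ (-α)) := by
  have hd : 0 < Metric.infDist x Ωᶜ :=
    (hΩ.isClosed_compl.notMem_iff_infDist_pos hΩc).1 (by simpa using hx)
  rw [← tail_lintegral n hn α _ hα hd]
  rw [← lintegral_sub_right_eq_self (μ := volume) (fun y : EuclideanSpace ℝ (Fin n) =>
      ENNReal.ofReal ((Set.Ici (Metric.infDist x Ωᶜ)).indicator
        (fun r : ℝ => r ^ (-(n : ℝ) - α)) ‖y‖)) x, ← lintegral_indicator hΩ.measurableSet.compl]
  apply lintegral_mono
  intro y
  by_cases hy : y ∈ Ωᶜ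
  · have h1 : Metric.infDist x Ωᶜ ≤ ‖y - x‖ := by
      rw [← dist_eq_norm, dist_comm]
      exact Metric.infDist_le_dist_of_mem hy
    have h2 : ‖y - x‖ ∈ Set.Ici (Metric.infDist x Ωᶜ) := h1
    simp only [Set.indicator_of_mem hy, Set.indicator_of_mem h2]
    rw [dist_comm, dist_eq_norm]
  · simp [Set.indicator_of_notMem hy]

/-- If the fractional Hardy inequality holds on `Ω` with constant `D > 0` and the fractional
Sobolev inequality holds on `ℝⁿ` with constant `S > 0`, then the fractional Sobolev inequality
holds on `Ω` with constant `S·(1 + 2|𝕊^{n−1}|/(αD))⁻¹`. -/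
theorem sobolev_on_domain_from_hardy (n : ℕ) (hn : 1 ≤ n) (p α D S pstar : ℝ)
    (hp : 2 ≤ p) (hα1 : 1 < α) (hαn : α < n) (hαp : α < p) (hD : 0 < D) (hS : 0 < S)
    (hpstar : pstar = n * p / ((n : ℝ) - α))
    (Ω : Set (EuclideanSpace ℝ (Fin n))) (hΩ : IsOpen Ω) (hΩc : Ωᶜ.Nonempty)
    (hHardy : ∀ f : EuclideanSpace ℝ (Fin n) → ℝ, ContDiff ℝ (⊤ : ℕ∞) f → HasCompactSupport f →
      tsupport f ⊆ Ω →
      ENNReal.ofReal D *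
          ∫⁻ x in Ω, ENNReal.ofReal (|f x| ^ p * Metric.infDist x Ωᶜ ^ (-α)) ≤
        ∫⁻ z in Ω ×ˢ Ω,
          ENNReal.ofReal (|f z.1 - f z.2| ^ p * dist z.1 z.2 ^ (-(n : ℝ) - α)))
    (hSobolev : ∀ f : EuclideanSpace ℝ (Fin n) → ℝ, ContDiff ℝ (⊤ : ℕ∞) f → HasCompactSupport f →
      ENNReal.ofReal S * (∫⁻ x, ENNReal.ofReal (|f x| ^ pstar)) ^ (p / pstar) ≤
        ∫⁻ z : EuclideanSpace ℝ (Fin n) × EuclideanSpace ℝ (Fin n),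
          ENNReal.ofReal (|f z.1 - f z.2| ^ p * dist z.1 z.2 ^ (-(n : ℝ) - α))) :
    ∀ f : EuclideanSpace ℝ (Fin n) → ℝ, ContDiff ℝ (⊤ : ℕ∞) f → HasCompactSupport f →
      tsupport f ⊆ Ω →
      ENNReal.ofReal
          (S * (1 + 2 * (2 * π ^ ((n : ℝ) / 2) / Real.Gamma ((n : ℝ) / 2)) / (α * D))⁻¹) *
          (∫⁻ x in Ω, ENNReal.ofReal (|f x| ^ pstar)) ^ (p / pstar) ≤
        ∫⁻ z in Ω ×ˢ Ω,
          ENNReal.ofReal (|f z.1 - f z.2| ^ p * dist z.1 z.2 ^ (-(n : ℝ) - α)) := by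
  intro f hf hfc hfs
  have hα : 0 < α := by linarith
  have hp0 : 0 < p := by linarith
  have hn0 : (0 : ℝ) < n := by linarith
  have hG : 0 < Real.Gamma ((n : ℝ) / 2) := Real.Gamma_pos_of_pos (by positivity)
  set σ : ℝ := 2 * π ^ ((n : ℝ) / 2) / Real.Gamma ((n : ℝ) / 2) with hσ
  have hσ0 : 0 < σ := by positivity
  set F : EuclideanSpace ℝ (Fin n) × EuclideanSpace ℝ (Fin n) → ENNReal := fun z =>
    ENNReal.ofReal (|f z.1 - f z.2| ^ p * dist z.1 z.2 ^ (-(n : ℝ) - α)) with hF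
  have hfm : Measurable f := hf.continuous.measurable
  have hFm : Measurable F := by
    have h1 : Measurable fun z : EuclideanSpace ℝ (Fin n) × EuclideanSpace ℝ (Fin n) =>
        dist z.1 z.2 := measurable_dist
    have h2 : Measurable fun z : EuclideanSpace ℝ (Fin n) × EuclideanSpace ℝ (Fin n) =>
        |f z.1 - f z.2| :=
      (continuous_abs.measurable).comp
        ((hfm.comp measurable_fst).sub (hfm.comp measurable_snd))
    exact ((h2.pow_const p).mul (h1.pow_const _)).ennreal_ofReal
  have hf0 : ∀ x, x ∉ Ω → f x = 0 := fun x hx => image_eq_zero_of_notMem_tsupport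
    (fun h => hx (hfs h))
  have hΩm := hΩ.measurableSet
  set A := ∫⁻ z in Ω ×ˢ Ω, F z with hA
  set H := ∫⁻ x in Ω, ENNReal.ofReal (|f x| ^ p * Metric.infDist x Ωᶜ ^ (-α)) with hH
  have hB : ∫⁻ z in Ω ×ˢ Ωᶜ, F z ≤ ENNReal.ofReal (σ / α) * H := by
    rw [Measure.volume_eq_prod, setLIntegral_prod _ hFm.aemeasurable, hH,
      ← lintegral_const_mul' _ _ ENNReal.ofReal_ne_top]
    apply setLIntegral_mono' hΩm
    intro x hx
    have h1 : ∫⁻ y in Ωᶜ, F (x, y) =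
        ENNReal.ofReal (|f x| ^ p) * ∫⁻ y in Ωᶜ, ENNReal.ofReal (dist x y ^ (-(n : ℝ) - α)) := by
      rw [← lintegral_const_mul' _ _ ENNReal.ofReal_ne_top]
      apply setLIntegral_congr_fun hΩm.compl
      intro y hy
      simp only [hF]
      rw [hf0 y hy, sub_zero, ENNReal.ofReal_mul (by positivity)]
    rw [h1]
    refine (mul_le_mul_right (compl_potential n hn α hα Ω hΩ hΩc x hx) _).trans ?_
    rw [← ENNReal.ofReal_mul (by positivity), ← ENNReal.ofReal_mul (by positivity)]
    apply le_of_eq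
    congr 1
    ring
  have hC : ∫⁻ z in Ωᶜ ×ˢ Ω, F z = ∫⁻ z in Ω ×ˢ Ωᶜ, F z := by
    rw [Measure.volume_eq_prod, ← Measure.prod_restrict, ← Measure.prod_restrict,
      ← lintegral_prod_swap]
    congr 1
    ext z
    simp only [hF, Prod.fst_swap, Prod.snd_swap]
    rw [abs_sub_comm, dist_comm]
  have hE : ∫⁻ z in Ωᶜ ×ˢ Ωᶜ, F z = 0 := by
    rw [setLIntegral_congr_fun (g := fun _ => 0) (hΩm.compl.prod hΩm.compl)]
    · simp
    · intro z hz
      simp only [hF]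
      rw [hf0 _ hz.1, hf0 _ hz.2]
      simp [Real.zero_rpow hp0.ne']
  have hsplit : ∫⁻ z, F z ≤ A + 2 * (ENNReal.ofReal (σ / α) * H) := by
    have hu : (Set.univ : Set (EuclideanSpace ℝ (Fin n) × EuclideanSpace ℝ (Fin n))) =
        (Ω ×ˢ Ω ∪ Ω ×ˢ Ωᶜ) ∪ (Ωᶜ ×ˢ Ω ∪ Ωᶜ ×ˢ Ωᶜ) := by
      rw [← Set.prod_union, ← Set.prod_union, ← Set.union_prod]
      simp
    rw [← setLIntegral_univ, hu]
    calc _ ≤ _ := lintegral_union_le _ _ _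
      _ ≤ (A + ∫⁻ z in Ω ×ˢ Ωᶜ, F z) + ((∫⁻ z in Ωᶜ ×ˢ Ω, F z) + ∫⁻ z in Ωᶜ ×ˢ Ωᶜ, F z) :=
        add_le_add (lintegral_union_le _ _ _) (lintegral_union_le _ _ _)
      _ ≤ _ := by
        rw [hC, hE, add_zero, add_assoc, ← two_mul]
        gcongr
  have hHD : ENNReal.ofReal D * H ≤ A := hHardy f hf hfc hfs
  have hHA : H ≤ ENNReal.ofReal D⁻¹ * A := by
    calc H = ENNReal.ofReal D⁻¹ * (ENNReal.ofReal D * H) := by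
          rw [← mul_assoc, ← ENNReal.ofReal_mul (by positivity), inv_mul_cancel₀ hD.ne']
          simp
      _ ≤ _ := by gcongr
  set K : ℝ := 1 + 2 * σ / (α * D) with hK
  have hK0 : 0 < K := by positivity
  have hfin : A + 2 * (ENNReal.ofReal (σ / α) * H) ≤ ENNReal.ofReal K * A := by
    calc _ ≤ A + 2 * (ENNReal.ofReal (σ / α) * (ENNReal.ofReal D⁻¹ * A)) := by gcongr
      _ = ENNReal.ofReal K * A := by
        rw [hK, ENNReal.ofReal_add (by norm_num) (by positivity), ENNReal.ofReal_one,
          show 2 * σ / (α * D) = 2 * (σ / α * D⁻¹) by field_simp,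
          ENNReal.ofReal_mul (by norm_num), ENNReal.ofReal_mul (by positivity)]
        simp only [ENNReal.ofReal_ofNat]
        ring
  have hps : 0 ≤ p / pstar := by
    rw [hpstar]
    have : 0 < (n : ℝ) - α := by linarith
    positivity
  have hN : (∫⁻ x in Ω, ENNReal.ofReal (|f x| ^ pstar)) ^ (p / pstar) ≤
      (∫⁻ x, ENNReal.ofReal (|f x| ^ pstar)) ^ (p / pstar) :=
    ENNReal.rpow_le_rpow (setLIntegral_le_lintegral _ _) hps
  calc _ ≤ ENNReal.ofReal (S * K⁻¹) *
        (∫⁻ x, ENNReal.ofReal (|f x| ^ pstar)) ^ (p / pstar) := by gcongr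
    _ = ENNReal.ofReal K⁻¹ * (ENNReal.ofReal S *
        (∫⁻ x, ENNReal.ofReal (|f x| ^ pstar)) ^ (p / pstar)) := by
      rw [mul_comm S, ENNReal.ofReal_mul (by positivity), mul_assoc]
    _ ≤ ENNReal.ofReal K⁻¹ * (ENNReal.ofReal K * A) := by
      refine mul_le_mul_right ?_ _
      exact ((hSobolev f hf hfc).trans hsplit).trans hfin
    _ = A := by
      rw [← mul_assoc, ← ENNReal.ofReal_mul (by positivity), inv_mul_cancel₀ hK0.ne']
      simp
end

section
/- Conformal invariance of the fractional energy: for n ≥ 2, 0 < α < 2, and f ∈ C_c(ℝⁿ), I_α(f) = I_α(\tilde f), where I_α(g) = ∫_{ℝⁿ×ℝⁿ} |g(x)−g(y)|²/|x−y|^{n+α} dx dy and \tilde f(ω) = η(ω)^{(n−α)/2} f(Tω), with the convention that I_α(\tilde f) = ∞ if I_α(f) = ∞. -/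
open MeasureTheory

/-- The last coordinate of a point of `ℝⁿ` (zero when `n = 0`). -/
noncomputable def lastCoord {n : ℕ} (x : EuclideanSpace ℝ (Fin n)) : ℝ :=
  if h : 0 < n then x ⟨n - 1, by omega⟩ else 0

/-- `η(ω) = 2/(|ω'|² + (ω_n + 1)²) = 2/(‖ω‖² + 2ω_n + 1)`. -/
noncomputable def eta {n : ℕ} (x : EuclideanSpace ℝ (Fin n)) : ℝ :=
  2 / (‖x‖ ^ 2 + 2 * lastCoord x + 1)

/-- The conformal map `Tω = η(ω)(ω', (1 − ‖ω‖²)/2)` from the unit ball onto the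
upper halfspace. -/
noncomputable def Tmap {n : ℕ} (x : EuclideanSpace ℝ (Fin n)) : EuclideanSpace ℝ (Fin n) :=
  (EuclideanSpace.equiv (Fin n) ℝ).symm
    (fun i => if (i : ℕ) = n - 1 then eta x * (1 - ‖x‖ ^ 2) / 2 else eta x * x i)


set_option linter.unusedSectionVars false

namespace FracConf

open EuclideanGeometry Module Set

variable {E : Type*} [NormedAddCommGroup E] [InnerProductSpace ℝ E] [FiniteDimensional ℝ E]
  [MeasurableSpace E] [BorelSpace E]

/-- Change of variables by an inversion. -/
theorem cov [Nontrivial E] (p : E) {R : ℝ} (hR : R ≠ 0) (g : E → ENNReal) :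
    ∫⁻ x, g x = ∫⁻ x, ENNReal.ofReal (((R / dist x p) ^ 2) ^ finrank ℝ E) *
      g (inversion p R x) := by
  have him : inversion p R '' {p}ᶜ = {p}ᶜ := by
    rw [image_compl_eq (inversion_bijective p hR)]
    simp
  have h := lintegral_image_eq_lintegral_abs_det_fderiv_mul (volume : Measure E)
    (s := {p}ᶜ) (f := inversion p R)
    (f' := fun x => (R / dist x p) ^ 2 • ((ℝ ∙ (x - p))ᗮ.reflection : E →L[ℝ] E))
    (measurableSet_singleton p).compl
    (fun x hx => (hasFDerivAt_inversion hx).hasFDerivWithinAt)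
    (inversion_injective p hR).injOn g
  rw [him, restrict_compl_singleton] at h
  rw [h]
  refine lintegral_congr fun x => ?_
  congr 2
  have hdet : (((ℝ ∙ (x - p))ᗮ.reflection : E →L[ℝ] E)).det
      = (-1) ^ finrank ℝ ((ℝ ∙ (x - p))ᗮᗮ : Submodule ℝ E) :=
    Submodule.det_reflection _
  have : ((R / dist x p) ^ 2 • ((ℝ ∙ (x - p))ᗮ.reflection : E →L[ℝ] E)).det
      = ((R / dist x p) ^ 2) ^ finrank ℝ E *
        (((ℝ ∙ (x - p))ᗮ.reflection : E →L[ℝ] E)).det := by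
    simp only [ContinuousLinearMap.det]
    rw [← LinearMap.det_smul]
    rfl
  rw [this, hdet, abs_mul, abs_pow (-1 : ℝ)]
  simp

/-- truncated kernel -/
noncomputable def K (p : E) (ε β : ℝ) (x y : E) : ℝ :=
  if ε * (dist x p * dist y p) < dist x y ^ 2 then dist x y ^ β else 0


theorem K_nonneg (p : E) (ε β : ℝ) (x y : E) : 0 ≤ K p ε β x y := by
  unfold K; split_ifs <;> positivity


theorem K_symm (p : E) (ε β : ℝ) (x y : E) : K p ε β x y = K p ε β y x := by
  unfold K; rw [dist_comm x y, mul_comm (dist x p)]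

@[fun_prop]
theorem K_meas (p : E) (ε β : ℝ) : Measurable (fun z : E × E => K p ε β z.1 z.2) := by
  unfold K
  refine Measurable.ite (measurableSet_lt ?_ ?_) ?_ ?_ <;> fun_prop


theorem K_inv (p : E) (ε β : ℝ) {x y : E} (hx : x ≠ p) (hy : y ≠ p) {R : ℝ} (hR : 0 < R) :
    K p ε β (inversion p R x) (inversion p R y)
      = (R ^ 2 / (dist x p * dist y p)) ^ β * K p ε β x y := by
  have hs : 0 < dist x p := dist_pos.2 hx
  have ht : 0 < dist y p := dist_pos.2 hy
  unfold K
  rw [dist_inversion_inversion hx hy, dist_inversion_center, dist_inversion_center]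
  have : (ε * (R ^ 2 / dist x p * (R ^ 2 / dist y p)) <
      (R ^ 2 / (dist x p * dist y p) * dist x y) ^ 2) ↔
      ε * (dist x p * dist y p) < dist x y ^ 2 := by
    have e1 : ε * (R ^ 2 / dist x p * (R ^ 2 / dist y p))
      = (R ^ 2 / (dist x p * dist y p)) ^ 2 * (ε * (dist x p * dist y p)) := by
      field_simp
    rw [e1, mul_pow]
    exact mul_lt_mul_iff_right₀ (by positivity)
  simp only [this]
  split_ifs
  · rw [Real.mul_rpow (by positivity) (by positivity)]
  · simp

/-- Slice identity. -/
theorem slice [Nontrivial E] (p : E) (ε α : ℝ) {x : E} (hx : x ≠ p) :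
    ∫⁻ y, ENNReal.ofReal ((dist x p / dist y p) ^ ((finrank ℝ E : ℝ) - α) *
        K p ε (-(finrank ℝ E : ℝ) - α) x y)
      = ∫⁻ y, ENNReal.ofReal (K p ε (-(finrank ℝ E : ℝ) - α) x y) := by
  have hs : 0 < dist x p := dist_pos.2 hx
  rw [cov p hs.ne' (fun y => ENNReal.ofReal (K p ε (-(finrank ℝ E : ℝ) - α) x y))]
  refine lintegral_congr_ae ?_
  filter_upwards [compl_mem_ae_iff.2 (measure_singleton (μ := (volume : Measure E)) p)] with y hy
  have hy : y ≠ p := hy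
  have ht : 0 < dist y p := dist_pos.2 hy
  have h := K_inv p ε (-(finrank ℝ E : ℝ) - α) hx hy hs
  rw [inversion_dist_center] at h
  rw [h, ← ENNReal.ofReal_mul (by positivity), ← mul_assoc]
  congr 2
  have : dist x p ^ 2 / (dist x p * dist y p) = dist x p / dist y p := by field_simp
  rw [this, ← pow_mul, ← Real.rpow_natCast, ← Real.rpow_add (by positivity)]
  congr 1
  push_cast; ring

theorem ae_ne [Nontrivial E] (p : E) : ∀ᵐ x : E, x ≠ p :=
  compl_mem_ae_iff.2 (measure_singleton (μ := (volume : Measure E)) p)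

theorem inversion_meas (p : E) (R : ℝ) : Measurable (inversion p R : E → E) := by
  have : (inversion p R : E → E) = fun x => (R / dist x p) ^ 2 • (x - p) + p := rfl
  rw [this]
  fun_prop

/-- scalar identity behind the conformal covariance -/
theorem scalar_id (n : ℕ) (α s t u v k : ℝ) (hs : 0 < s) (ht : 0 < t) :
    ((√2 / s) ^ 2) ^ n * (((√2 / t) ^ 2) ^ n *
      (((2 / (√2 ^ 2 / s) ^ 2) ^ (((n : ℝ) - α) / 2) * u -
        (2 / (√2 ^ 2 / t) ^ 2) ^ (((n : ℝ) - α) / 2) * v) ^ 2 *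
        ((√2 ^ 2 / (s * t)) ^ (-(n : ℝ) - α) * k)))
    = (s ^ ((n : ℝ) - α) * u - t ^ ((n : ℝ) - α) * v) ^ 2 * (s * t) ^ (-((n : ℝ) - α)) * k := by
  have h2 : (√2 : ℝ) ^ 2 = 2 := Real.sq_sqrt (by norm_num)
  have key : ∀ r : ℝ, 0 < r → (2 / (√2 ^ 2 / r) ^ 2) ^ (((n : ℝ) - α) / 2)
      = r ^ ((n : ℝ) - α) * 2 ^ (-(((n : ℝ) - α) / 2)) := by
    intro r hr
    rw [h2]
    have : 2 / (2 / r) ^ 2 = r ^ (2 : ℝ) * 2⁻¹ := by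
      rw [Real.rpow_two]; field_simp
    rw [this, Real.mul_rpow (by positivity) (by positivity), ← Real.rpow_mul hr.le,
      Real.inv_rpow (by norm_num), ← Real.rpow_neg (by norm_num)]
    congr 2; ring
  rw [key s hs, key t ht, div_pow √2 s, div_pow √2 t, h2]
  have e1 : (2 / s ^ 2) ^ n * (2 / t ^ 2) ^ n = (2 : ℝ) ^ (2 * n : ℝ) * (s * t) ^ (-(2 * n : ℝ)) := by
    rw [← mul_pow, Real.rpow_neg (by positivity)]
    have : (2 * n : ℝ) = ((2 * n : ℕ) : ℝ) := by push_cast; ring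
    rw [this, Real.rpow_natCast, Real.rpow_natCast, pow_mul, pow_mul, ← inv_pow, ← mul_pow]
    congr 1
    field_simp
  have e2 : (2 / (s * t)) ^ (-(n : ℝ) - α) = 2 ^ (-(n : ℝ) - α) * (s * t) ^ ((n : ℝ) + α) := by
    rw [div_eq_mul_inv, Real.mul_rpow (by positivity) (by positivity),
      Real.inv_rpow (by positivity), ← Real.rpow_neg (by positivity)]
    congr 2; ring
  have e3 : (2 : ℝ) ^ (2 * n : ℝ) * (2 ^ (-(((n : ℝ) - α) / 2))) ^ 2 * 2 ^ (-(n : ℝ) - α) = 1 := by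
    rw [← Real.rpow_natCast (2 ^ (-(((n : ℝ) - α) / 2)) : ℝ), ← Real.rpow_mul (by norm_num),
      ← Real.rpow_add (by norm_num), ← Real.rpow_add (by norm_num)]
    convert Real.rpow_zero 2
    push_cast; ring
  have e4 : (s * t) ^ (-(2 * n : ℝ)) * (s * t) ^ ((n : ℝ) + α) = (s * t) ^ (-((n : ℝ) - α)) := by
    rw [← Real.rpow_add (by positivity)]; congr 1; ring
  rw [← mul_assoc, e1, e2, ← e4]
  linear_combination ((s ^ ((n : ℝ) - α) * u - t ^ ((n : ℝ) - α) * v) ^ 2 *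
    ((s * t) ^ (-(2 * n : ℝ)) * (s * t) ^ ((n : ℝ) + α)) * k) * e3

theorem tstep [Nontrivial E] (p : E) (ε α : ℝ) (f : E → ℝ) (hf : Measurable f) :
    ∫⁻ z : E × E, ENNReal.ofReal
      (((2 / dist z.1 p ^ 2) ^ (((finrank ℝ E : ℝ) - α) / 2) * f (inversion p √2 z.1) -
        (2 / dist z.2 p ^ 2) ^ (((finrank ℝ E : ℝ) - α) / 2) * f (inversion p √2 z.2)) ^ 2 *
        K p ε (-(finrank ℝ E : ℝ) - α) z.1 z.2)
    = ∫⁻ z : E × E, ENNReal.ofReal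
      ((dist z.1 p ^ ((finrank ℝ E : ℝ) - α) * f z.1 -
        dist z.2 p ^ ((finrank ℝ E : ℝ) - α) * f z.2) ^ 2 *
        (dist z.1 p * dist z.2 p) ^ (-((finrank ℝ E : ℝ) - α)) *
        K p ε (-(finrank ℝ E : ℝ) - α) z.1 z.2) := by
  have hT := inversion_meas p √2
  have hr : √2 ≠ 0 := by positivity
  rw [Measure.volume_eq_prod, lintegral_prod _ (by fun_prop), lintegral_prod _ (by fun_prop)]
  rw [cov p hr]
  refine lintegral_congr_ae ?_
  filter_upwards [ae_ne p] with x hx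
  rw [cov p hr, ← lintegral_const_mul' _ _ ENNReal.ofReal_ne_top]
  refine lintegral_congr_ae ?_
  filter_upwards [ae_ne p] with y hy
  have hs : 0 < dist x p := dist_pos.2 hx
  have ht : 0 < dist y p := dist_pos.2 hy
  rw [← ENNReal.ofReal_mul (by positivity), ← ENNReal.ofReal_mul (by positivity),
    inversion_inversion p hr, inversion_inversion p hr, dist_inversion_center,
    dist_inversion_center, K_inv p ε _ hx hy (by positivity)]
  congr 1
  exact scalar_id _ _ _ _ _ _ _ hs ht

/-- radial integrability -/
theorem radial [Nontrivial E] (α c R : ℝ) (hα : 0 < α) (hαn : α < finrank ℝ E) (hc : 0 < c)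
    (hR : 0 < R) :
    Integrable (fun z : E => ‖z‖ ^ (-(finrank ℝ E : ℝ) - α) *
      (min R (‖z‖ / c)) ^ finrank ℝ E) := by
  have hn : 0 < finrank ℝ E := finrank_pos
  set n := finrank ℝ E with hndef
  have hcast : ((n - 1 : ℕ) : ℝ) = (n : ℝ) - 1 := by
    rw [Nat.cast_sub (by omega)]; simp
  refine (integrable_fun_norm_addHaar (volume : Measure E)
    (f := fun r => r ^ (-(n : ℝ) - α) * (min R (r / c)) ^ n)).2 ?_
  rw [← Ioc_union_Ioi_eq_Ioi (zero_le_one' ℝ)]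
  have hm : Measurable fun y : ℝ => y ^ (n - 1) • (y ^ (-(n : ℝ) - α) * (min R (y / c)) ^ n) := by
    fun_prop
  refine IntegrableOn.union ?_ ?_
  · have h1 : IntegrableOn (fun y : ℝ => y ^ ((n : ℝ) - 1 - α) * c⁻¹ ^ n) (Ioc 0 1) := by
      have := (intervalIntegral.intervalIntegrable_rpow' (a := 0) (b := 1)
        (r := (n : ℝ) - 1 - α) (by linarith))
      rw [intervalIntegrable_iff_integrableOn_Ioc_of_le zero_le_one] at this
      exact this.mul_const _
    refine Integrable.mono' h1 hm.aestronglyMeasurable ?_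
    refine (ae_restrict_iff' measurableSet_Ioc).2 (Filter.Eventually.of_forall fun y hy => ?_)
    have hy0 : 0 < y := hy.1
    rw [Real.norm_of_nonneg (by positivity), smul_eq_mul]
    calc y ^ (n - 1) * (y ^ (-(n : ℝ) - α) * (min R (y / c)) ^ n)
        ≤ y ^ (n - 1) * (y ^ (-(n : ℝ) - α) * (y / c) ^ n) := by
          gcongr; exact min_le_right _ _
      _ = (y ^ ((n - 1 : ℕ) : ℝ) * y ^ (-(n : ℝ) - α) * y ^ (n : ℝ)) * c⁻¹ ^ n := by
          rw [Real.rpow_natCast, Real.rpow_natCast, div_eq_mul_inv, mul_pow]; ring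
      _ = _ := by
          rw [← Real.rpow_add hy0, ← Real.rpow_add hy0, hcast]; congr 2; ring
  · have h1 : IntegrableOn (fun y : ℝ => y ^ (-1 - α) * R ^ n) (Ioi 1) :=
      (integrableOn_Ioi_rpow_of_lt (by linarith) zero_lt_one).mul_const _
    refine Integrable.mono' h1 hm.aestronglyMeasurable ?_
    refine (ae_restrict_iff' measurableSet_Ioi).2 (Filter.Eventually.of_forall fun y hy => ?_)
    have hy0 : 0 < y := zero_lt_one.trans hy
    rw [Real.norm_of_nonneg (by positivity), smul_eq_mul]
    calc y ^ (n - 1) * (y ^ (-(n : ℝ) - α) * (min R (y / c)) ^ n)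
        ≤ y ^ (n - 1) * (y ^ (-(n : ℝ) - α) * R ^ n) := by
          gcongr; exact min_le_left _ _
      _ = (y ^ ((n - 1 : ℕ) : ℝ) * y ^ (-(n : ℝ) - α)) * R ^ n := by
          rw [Real.rpow_natCast]; ring
      _ = _ := by
          rw [← Real.rpow_add hy0, hcast]; congr 2; ring

theorem K_le (p : E) (ε β : ℝ) (hε : 0 < ε) : ∃ c > 0, ∀ x y : E,
    K p ε β x y ≤ if c * dist x p ≤ ‖x - y‖ then ‖x - y‖ ^ β else 0 := by
  refine ⟨min (1 / 2) √(ε / 2), by positivity, fun x y => ?_⟩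
  unfold K
  rw [← dist_eq_norm]
  by_cases h : ε * (dist x p * dist y p) < dist x y ^ 2
  · rw [if_pos h, if_pos]
    have htri : dist x p ≤ dist x y + dist y p := dist_triangle _ _ _
    have h0 : 0 ≤ dist x p := dist_nonneg
    rcases le_total (dist y p) (dist x p / 2) with h1 | h1
    · calc min (1 / 2) √(ε / 2) * dist x p ≤ 1 / 2 * dist x p := by
            gcongr; exact min_le_left _ _
        _ ≤ _ := by linarith
    · calc min (1 / 2) √(ε / 2) * dist x p ≤ √(ε / 2) * dist x p := by
            gcongr; exact min_le_right _ _
        _ ≤ _ := by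
          apply le_of_sq_le_sq _ dist_nonneg
          rw [mul_pow, Real.sq_sqrt (by positivity)]
          have : dist x p * (dist x p / 2) ≤ dist x p * dist y p := by gcongr
          nlinarith
  · rw [if_neg h]; split_ifs <;> positivity

theorem fin_int [Nontrivial E] (p : E) (ε α : ℝ) (hε : 0 < ε) (hα : 0 < α)
    (hαn : α < finrank ℝ E) (f : E → ℝ) (hf : Continuous f) (hfc : HasCompactSupport f) :
    ∫⁻ z : E × E, ENNReal.ofReal (f z.1 ^ 2 * K p ε (-(finrank ℝ E : ℝ) - α) z.1 z.2) ≠ ⊤ := by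
  obtain ⟨M, hM⟩ := hf.bounded_above_of_compact_support hfc
  obtain ⟨R, hRpos, hR⟩ := hfc.isCompact.isBounded.subset_closedBall_lt 0 p
  obtain ⟨c, hc, hK⟩ := K_le p ε (-(finrank ℝ E : ℝ) - α) hε
  set n := finrank ℝ E with hn
  let G : E → E → ENNReal := fun x w =>
    if dist x p ≤ R ∧ c * dist x p ≤ ‖w‖ then ENNReal.ofReal (M ^ 2 * ‖w‖ ^ (-(n : ℝ) - α)) else 0
  have hGm : Measurable (Function.uncurry G) := by
    refine Measurable.ite ?_ (by fun_prop) (by fun_prop)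
    have m1 : MeasurableSet {a : E × E | dist a.1 p ≤ R} :=
      measurableSet_le (by fun_prop) (by fun_prop)
    have m2 : MeasurableSet {a : E × E | c * dist a.1 p ≤ ‖a.2‖} :=
      measurableSet_le (by fun_prop) (by fun_prop)
    exact m1.inter m2
  have hle : ∀ x y : E, ENNReal.ofReal (f x ^ 2 * K p ε (-(n : ℝ) - α) x y) ≤ G x (x - y) := by
    intro x y
    by_cases hx : dist x p ≤ R
    · have h1 : f x ^ 2 ≤ M ^ 2 := by
        rw [← sq_abs]; exact pow_le_pow_left₀ (abs_nonneg _) (hM x) 2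
      have h2 := hK x y
      by_cases h3 : c * dist x p ≤ ‖x - y‖
      · rw [if_pos h3] at h2
        simp only [G, hx, h3, and_self, if_true]
        exact ENNReal.ofReal_le_ofReal (mul_le_mul h1 h2 (K_nonneg _ _ _ _ _) (sq_nonneg _))
      · rw [if_neg h3] at h2
        rw [le_antisymm h2 (K_nonneg _ _ _ _ _)]
        simp
    · have : f x = 0 := by
        by_contra h
        exact hx (hR (subset_tsupport f h))
      simp [this]
  have hfm := hf.measurable
  rw [Measure.volume_eq_prod, lintegral_prod _ (by fun_prop)]
  refine ne_top_of_le_ne_top ?_ (lintegral_mono fun x => lintegral_mono fun y => hle x y)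
  have hsub : ∀ x : E, ∫⁻ y, G x (x - y) = ∫⁻ w, G x w := fun x =>
    lintegral_sub_left_eq_self (G x) x
  simp_rw [hsub]
  rw [lintegral_lintegral_swap hGm.aemeasurable]
  have hin : ∀ w : E, ∫⁻ x, G x w ≤ ENNReal.ofReal (M ^ 2) * volume (Metric.ball (0 : E) 1) *
      ENNReal.ofReal (‖w‖ ^ (-(n : ℝ) - α) * (min R (‖w‖ / c)) ^ n) := by
    intro w
    have : ∀ x, G x w = (Metric.closedBall p (min R (‖w‖ / c))).indicator
        (fun _ => ENNReal.ofReal (M ^ 2 * ‖w‖ ^ (-(n : ℝ) - α))) x := by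
      intro x
      simp only [G, indicator, Metric.mem_closedBall, le_min_iff, le_div_iff₀ hc, mul_comm c]
    simp_rw [this]
    rw [lintegral_indicator_const Metric.isClosed_closedBall.measurableSet,
      Measure.addHaar_closedBall _ _ (by positivity), ENNReal.ofReal_mul (by positivity),
      ENNReal.ofReal_mul (by positivity)]
    apply le_of_eq
    ring
  refine ne_top_of_le_ne_top ?_ (lintegral_mono hin)
  rw [lintegral_const_mul' _ _ (ENNReal.mul_ne_top ENNReal.ofReal_ne_top
    measure_ball_lt_top.ne)]
  refine ENNReal.mul_ne_top (ENNReal.mul_ne_top ENNReal.ofReal_ne_top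
    measure_ball_lt_top.ne) ?_
  have := (radial (E := E) α c R hα hαn hc hRpos).lintegral_lt_top
  exact this.ne

theorem trunc [Nontrivial E] (p : E) (ε α : ℝ) (hε : 0 < ε) (hα : 0 < α)
    (hαn : α < finrank ℝ E) (f : E → ℝ) (hf : Continuous f) (hfc : HasCompactSupport f) :
    ∫⁻ z : E × E, ENNReal.ofReal ((f z.1 - f z.2) ^ 2 *
        K p ε (-(finrank ℝ E : ℝ) - α) z.1 z.2) =
    ∫⁻ z : E × E, ENNReal.ofReal
      (((2 / dist z.1 p ^ 2) ^ (((finrank ℝ E : ℝ) - α) / 2) * f (inversion p √2 z.1) -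
        (2 / dist z.2 p ^ 2) ^ (((finrank ℝ E : ℝ) - α) / 2) * f (inversion p √2 z.2)) ^ 2 *
        K p ε (-(finrank ℝ E : ℝ) - α) z.1 z.2) := by
  have hfm := hf.measurable
  rw [tstep p ε α f hfm]
  have hfin := fin_int p ε α hε hα hαn f hf hfc
  set n := finrank ℝ E with hn
  set k : E → E → ℝ := K p ε (-(n : ℝ) - α) with hk
  have hkm : Measurable (fun z : E × E => k z.1 z.2) := K_meas _ _ _
  have hk0 : ∀ x y, 0 ≤ k x y := K_nonneg _ _ _
  let A : E × E → ENNReal := fun z =>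
    ENNReal.ofReal (f z.1 ^ 2 * ((dist z.1 p / dist z.2 p) ^ ((n : ℝ) - α) * k z.1 z.2))
  let C : E × E → ENNReal := fun z => ENNReal.ofReal (f z.1 ^ 2 * k z.1 z.2)
  have hAm : Measurable A := by fun_prop
  have hCm : Measurable C := by fun_prop
  have hAC : ∫⁻ z, A z = ∫⁻ z, C z := by
    rw [Measure.volume_eq_prod, lintegral_prod _ hAm.aemeasurable,
      lintegral_prod _ hCm.aemeasurable]
    refine lintegral_congr_ae ?_
    filter_upwards [ae_ne p] with x hx
    simp only [A, C]
    simp_rw [ENNReal.ofReal_mul (sq_nonneg (f x))]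
    rw [lintegral_const_mul' _ _ ENNReal.ofReal_ne_top,
      lintegral_const_mul' _ _ ENNReal.ofReal_ne_top]
    congr 1
    exact slice p ε α hx
  have hswap : ∀ g : E × E → ENNReal, ∫⁻ z : E × E, g z.swap = ∫⁻ z, g z := fun g => by
    rw [Measure.volume_eq_prod]; exact lintegral_prod_swap g
  have hsum : ∫⁻ z : E × E, (ENNReal.ofReal ((f z.1 - f z.2) ^ 2 * k z.1 z.2) +
        (A z + A z.swap)) =
      ∫⁻ z : E × E, (ENNReal.ofReal ((dist z.1 p ^ ((n : ℝ) - α) * f z.1 -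
        dist z.2 p ^ ((n : ℝ) - α) * f z.2) ^ 2 *
        (dist z.1 p * dist z.2 p) ^ (-((n : ℝ) - α)) * k z.1 z.2) + (C z + C z.swap)) := by
    refine lintegral_congr_ae ?_
    have a1 : ∀ᵐ z : E × E, z.1 ≠ p := Measure.quasiMeasurePreserving_fst.ae (ae_ne p)
    have a2 : ∀ᵐ z : E × E, z.2 ≠ p := Measure.quasiMeasurePreserving_snd.ae (ae_ne p)
    filter_upwards [a1, a2] with z hx hy
    obtain ⟨x, y⟩ := z
    have hs : 0 < dist x p := dist_pos.2 hx
    have ht : 0 < dist y p := dist_pos.2 hy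
    have hkk := hk0 x y
    have hsym : k y x = k x y := K_symm _ _ _ _ _
    simp only [A, C, Prod.swap, hsym]
    rw [← ENNReal.ofReal_add (by positivity) (by positivity),
      ← ENNReal.ofReal_add (by positivity) (by positivity),
      ← ENNReal.ofReal_add (by positivity) (by positivity),
      ← ENNReal.ofReal_add (by positivity) (by positivity)]
    congr 1
    rw [Real.div_rpow hs.le ht.le, Real.div_rpow ht.le hs.le, Real.rpow_neg (by positivity),
      Real.mul_rpow hs.le ht.le]
    have h1 : 0 < dist x p ^ ((n : ℝ) - α) := by positivity
    have h2 : 0 < dist y p ^ ((n : ℝ) - α) := by positivity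
    field_simp
    ring
  have hAs : Measurable fun z : E × E => A z.swap := hAm.comp measurable_swap
  have hCs : Measurable fun z : E × E => C z.swap := hCm.comp measurable_swap
  have hA2 : Measurable fun z : E × E => A z + A z.swap := hAm.add hAs
  have hC2 : Measurable fun z : E × E => C z + C z.swap := hCm.add hCs
  rw [lintegral_add_right _ hA2, lintegral_add_right _ hC2,
    lintegral_add_left hAm, lintegral_add_left hCm, hswap A, hswap C, hAC] at hsum
  exact (ENNReal.add_left_inj (ENNReal.add_ne_top.2 ⟨hfin, hfin⟩)).1 hsum

theorem sup_eq (p : E) (β : ℝ) (g : E → ℝ) (hg : Measurable g) :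
    ∫⁻ z : E × E, ENNReal.ofReal ((g z.1 - g z.2) ^ 2 * dist z.1 z.2 ^ β) =
    ⨆ m : ℕ, ∫⁻ z : E × E, ENNReal.ofReal ((g z.1 - g z.2) ^ 2 *
      K p (1 / ((m : ℝ) + 1)) β z.1 z.2) := by
  rw [← lintegral_iSup (fun m => by fun_prop)]
  · refine lintegral_congr fun z => ?_
    obtain ⟨x, y⟩ := z
    apply le_antisymm
    · rcases eq_or_ne x y with rfl | hxy
      · simp
      · have hd : 0 < dist x y ^ 2 := by have := dist_pos.2 hxy; positivity
        obtain ⟨m, hm⟩ := exists_nat_gt ((dist x p * dist y p) / dist x y ^ 2)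
        refine le_iSup_of_le m ?_
        have : 1 / ((m : ℝ) + 1) * (dist x p * dist y p) < dist x y ^ 2 := by
          rw [div_lt_iff₀ hd] at hm
          rw [one_div, inv_mul_lt_iff₀ (by positivity)]
          nlinarith
        simp only [K, this, if_true]
        exact le_rfl
    · refine iSup_le fun m => ?_
      refine ENNReal.ofReal_le_ofReal (mul_le_mul_of_nonneg_left ?_ (sq_nonneg _))
      unfold K
      split_ifs
      · exact le_rfl
      · positivity
  · intro m m' hmm z
    refine ENNReal.ofReal_le_ofReal (mul_le_mul_of_nonneg_left ?_ (sq_nonneg _))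
    have : 1 / ((m' : ℝ) + 1) * (dist z.1 p * dist z.2 p) ≤
        1 / ((m : ℝ) + 1) * (dist z.1 p * dist z.2 p) := by
      gcongr
    unfold K
    split_ifs with h1 h2 h2
    · exact le_rfl
    · exact absurd (this.trans_lt h1) h2
    · positivity
    · exact le_rfl

theorem energy [Nontrivial E] (p : E) (α : ℝ) (hα : 0 < α)
    (hαn : α < finrank ℝ E) (f : E → ℝ) (hf : Continuous f) (hfc : HasCompactSupport f) :
    ∫⁻ z : E × E, ENNReal.ofReal ((f z.1 - f z.2) ^ 2 *
        dist z.1 z.2 ^ (-(finrank ℝ E : ℝ) - α)) =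
    ∫⁻ z : E × E, ENNReal.ofReal
      (((2 / dist z.1 p ^ 2) ^ (((finrank ℝ E : ℝ) - α) / 2) * f (inversion p √2 z.1) -
        (2 / dist z.2 p ^ 2) ^ (((finrank ℝ E : ℝ) - α) / 2) * f (inversion p √2 z.2)) ^ 2 *
        dist z.1 z.2 ^ (-(finrank ℝ E : ℝ) - α)) := by
  have hfm := hf.measurable
  have hT := inversion_meas p √2
  rw [sup_eq p _ f hfm, sup_eq p _ (fun x =>
    (2 / dist x p ^ 2) ^ (((finrank ℝ E : ℝ) - α) / 2) * f (inversion p √2 x)) (by fun_prop)]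
  exact iSup_congr fun m => trunc p _ α (by positivity) hα hαn f hf hfc

end FracConf

theorem eta_eq_aux {n : ℕ} (hn : 0 < n) (x : EuclideanSpace ℝ (Fin n)) :
    eta x = 2 / dist x (EuclideanSpace.single ⟨n - 1, by omega⟩ (-1 : ℝ)) ^ 2 := by
  unfold eta lastCoord
  rw [dif_pos hn, dist_eq_norm, norm_sub_sq_real]
  simp [EuclideanSpace.inner_single_right]

theorem Tmap_eq_aux {n : ℕ} (hn : 0 < n) (x : EuclideanSpace ℝ (Fin n))
    (hx : x ≠ EuclideanSpace.single ⟨n - 1, by omega⟩ (-1 : ℝ)) :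
    Tmap x = EuclideanGeometry.inversion
      (EuclideanSpace.single ⟨n - 1, by omega⟩ (-1 : ℝ)) √2 x := by
  have he := eta_eq_aux hn x
  have hd := dist_pos.2 hx
  set p : EuclideanSpace ℝ (Fin n) := EuclideanSpace.single ⟨n - 1, by omega⟩ (-1 : ℝ) with hp
  have hsq : (√2 / dist x p) ^ 2 = eta x := by
    rw [he, div_pow, Real.sq_sqrt (by norm_num)]
  have hD : dist x p ^ 2 = ‖x‖ ^ 2 + 2 * x ⟨n - 1, by omega⟩ + 1 := by
    rw [dist_eq_norm, norm_sub_sq_real]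
    simp [hp, EuclideanSpace.inner_single_right]
  have hE : eta x * (‖x‖ ^ 2 + 2 * x ⟨n - 1, by omega⟩ + 1) = 2 := by
    rw [← hD, he]; field_simp
  ext i
  simp only [Tmap, EuclideanGeometry.inversion, hsq]
  by_cases hi : (i : ℕ) = n - 1
  · have hi' : i = ⟨n - 1, by omega⟩ := Fin.ext hi
    rw [hi']
    simp [hp]
    linarith
  · have hi' : i ≠ ⟨n - 1, by omega⟩ := fun h => hi (by rw [h])
    simp [hp, hi, hi']

/-- Conformal invariance of the fractional energy: `I_α(f) = I_α(f̃)` where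
`f̃(ω) = η(ω)^{(n−α)/2} f(Tω)`. -/
theorem fractional_energy_conformal_invariance (n : ℕ) (hn : 2 ≤ n) (α : ℝ)
    (hα0 : 0 < α) (hα2 : α < 2) (f : EuclideanSpace ℝ (Fin n) → ℝ)
    (hf : Continuous f) (hfc : HasCompactSupport f) :
    (∫⁻ z : EuclideanSpace ℝ (Fin n) × EuclideanSpace ℝ (Fin n),
        ENNReal.ofReal ((f z.1 - f z.2) ^ 2 * dist z.1 z.2 ^ (-(n : ℝ) - α))) =
      ∫⁻ z : EuclideanSpace ℝ (Fin n) × EuclideanSpace ℝ (Fin n),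
        ENNReal.ofReal
          ((eta z.1 ^ (((n : ℝ) - α) / 2) * f (Tmap z.1) -
              eta z.2 ^ (((n : ℝ) - α) / 2) * f (Tmap z.2)) ^ 2 *
            dist z.1 z.2 ^ (-(n : ℝ) - α)) := by
  have hn0 : 0 < n := by omega
  have : Nonempty (Fin n) := ⟨⟨0, hn0⟩⟩
  have hn2 : (2 : ℝ) ≤ n := by exact_mod_cast hn
  have h := FracConf.energy (E := EuclideanSpace ℝ (Fin n))
    (EuclideanSpace.single ⟨n - 1, by omega⟩ (-1 : ℝ)) α hα0
    (by rw [finrank_euclideanSpace_fin]; linarith) f hf hfc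
  simp only [finrank_euclideanSpace_fin] at h
  rw [h]
  have key : ∀ x : EuclideanSpace ℝ (Fin n),
      (2 / dist x (EuclideanSpace.single ⟨n - 1, by omega⟩ (-1 : ℝ)) ^ 2) ^ (((n : ℝ) - α) / 2) *
        f (EuclideanGeometry.inversion
          (EuclideanSpace.single ⟨n - 1, by omega⟩ (-1 : ℝ)) √2 x) =
      eta x ^ (((n : ℝ) - α) / 2) * f (Tmap x) := by
    intro x
    rw [← eta_eq_aux hn0 x]
    by_cases hx : x = EuclideanSpace.single ⟨n - 1, by omega⟩ (-1 : ℝ)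
    · have h0 : eta x = 0 := by rw [eta_eq_aux hn0 x, ← hx]; simp
      rw [h0, Real.zero_rpow (by linarith), zero_mul, zero_mul]
    · rw [Tmap_eq_aux hn0 x hx]
  refine lintegral_congr fun z => ?_
  rw [key, key]
end
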